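/- Let A be a (not necessarily unital or commutative) ring. Define Mac Lane's product of two degree-1 bar generators by [a|₁b]·[c|₁d] := [ac|₁bc|₁ad+bd] − [ac|₁ad|₁bc+bd] + [ad|₁bc|₁bd] − [bc|₁ad|₁bd] − [bc|₂ad] ∈ ℤ[A³]⊕ℤ[A²], and the products of a degree-0 with a degree-1 generator by [x]·[y|₁z] := [xy|₁xz] and [y|₁z]·[x] := [yx|₁zx]. Then for all a, b, c, d ∈ A the Leibniz rule ∂₂([a|₁b]·[c|₁d]) = (∂₁[a|₁b])·[c|₁d] − [a|₁b]·(∂₁[c|₁d]) holds in ℤ[A²]; explicitly, ∂₂ applied to the five-term sum above equals [bc|₁bd] − [(a+b)c|₁(a+b)d] + [ac|₁ad] − [ad|₁bd] + [a(c+d)|₁b(c+d)] − [ac|₁bc]. -/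

import Mathlib

/-!
Statement 3: for a (not necessarily unital or commutative) ring `A`, Mac Lane's
product of two degree-1 bar generators satisfies the Leibniz rule
`∂₂([a|₁b]·[c|₁d]) = (∂₁[a|₁b])·[c|₁d] − [a|₁b]·(∂₁[c|₁d])` in `ℤ[A²]`;
explicitly, `∂₂` applied to the five-term sum equals
`[bc|₁bd] − [(a+b)c|₁(a+b)d] + [ac|₁ad] − [ad|₁bd] + [a(c+d)|₁b(c+d)] − [ac|₁bc]`.
-/

open FreeAbelianGroup

variable (A : Type*) [NonUnitalRing A]

/-- `∂₁ : ℤ[A²] → ℤ[A]`, `[a|₁b] ↦ [b] − [a+b] + [a]`. -/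
def barD1 : FreeAbelianGroup (A × A) →+ FreeAbelianGroup A :=
  FreeAbelianGroup.lift fun p : A × A => of p.2 - of (p.1 + p.2) + of p.1

/-- `∂₂ : ℤ[A³] ⊕ ℤ[A²] → ℤ[A²]`, with
`[a|₁b|₁c] ↦ [b|₁c] − [a+b|₁c] + [a|₁b+c] − [a|₁b]` and `[a|₂b] ↦ [a|₁b] − [b|₁a]`. -/
def barD2 : FreeAbelianGroup (A × A × A) × FreeAbelianGroup (A × A) →+
    FreeAbelianGroup (A × A) :=
  (FreeAbelianGroup.lift fun p : A × A × A =>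
      of (p.2.1, p.2.2) - of (p.1 + p.2.1, p.2.2) + of (p.1, p.2.1 + p.2.2)
        - of (p.1, p.2.1)).coprod
  (FreeAbelianGroup.lift fun p : A × A =>
      of (p.1, p.2) - of (p.2, p.1))

/-- Mac Lane's product of two degree-1 generators, extended biadditively:
`[a|₁b]·[c|₁d] = [ac|₁bc|₁ad+bd] − [ac|₁ad|₁bc+bd] + [ad|₁bc|₁bd] − [bc|₁ad|₁bd]
− [bc|₂ad] ∈ ℤ[A³]⊕ℤ[A²]`. -/
def barMul11 : FreeAbelianGroup (A × A) →+ FreeAbelianGroup (A × A) →+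
    FreeAbelianGroup (A × A × A) × FreeAbelianGroup (A × A) :=
  FreeAbelianGroup.lift fun p : A × A => FreeAbelianGroup.lift fun q : A × A =>
    ((of (p.1 * q.1, p.2 * q.1, p.1 * q.2 + p.2 * q.2)
        - of (p.1 * q.1, p.1 * q.2, p.2 * q.1 + p.2 * q.2)
        + of (p.1 * q.2, p.2 * q.1, p.2 * q.2)
        - of (p.2 * q.1, p.1 * q.2, p.2 * q.2),
      -of (p.2 * q.1, p.1 * q.2)) :
      FreeAbelianGroup (A × A × A) × FreeAbelianGroup (A × A))

/-- The product of a degree-0 with a degree-1 generator, extended biadditively: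
`[x]·[y|₁z] = [xy|₁xz]`. -/
def barMul01 : FreeAbelianGroup A →+ FreeAbelianGroup (A × A) →+
    FreeAbelianGroup (A × A) :=
  FreeAbelianGroup.lift fun x : A => FreeAbelianGroup.lift fun q : A × A =>
    of (x * q.1, x * q.2)

/-- The product of a degree-1 with a degree-0 generator, extended biadditively:
`[y|₁z]·[x] = [yx|₁zx]`. -/
def barMul10 : FreeAbelianGroup (A × A) →+ FreeAbelianGroup A →+
    FreeAbelianGroup (A × A) :=
  FreeAbelianGroup.lift fun q : A × A => FreeAbelianGroup.lift fun x : A =>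
    of (q.1 * x, q.2 * x)

/-- Leibniz rule for Mac Lane's product of degree-1 bar generators, with its
explicit form. -/
theorem barMul_leibniz (A : Type*) [NonUnitalRing A] (a b c d : A) :
    barD2 A (barMul11 A (of (a, b)) (of (c, d))) =
        barMul01 A (barD1 A (of (a, b))) (of (c, d))
          - barMul10 A (of (a, b)) (barD1 A (of (c, d))) ∧
    barD2 A (barMul11 A (of (a, b)) (of (c, d))) =
        of (b * c, b * d) - of ((a + b) * c, (a + b) * d) + of (a * c, a * d)
          - of (a * d, b * d) + of (a * (c + d), b * (c + d)) - of (a * c, b * c) := by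
  have explicit : barD2 A (barMul11 A (of (a, b)) (of (c, d))) =
        of (b * c, b * d) - of ((a + b) * c, (a + b) * d) + of (a * c, a * d)
          - of (a * d, b * d) + of (a * (c + d), b * (c + d)) - of (a * c, b * c) := by
    simp only [barD2, barMul11, lift_apply_of, AddMonoidHom.coprod_apply, map_sub, map_add,
      map_neg, mul_add, add_mul, add_left_comm (b * c) (a * d) (b * d),
      add_comm (b * c) (a * d)]
    abel
  refine ⟨explicit.trans ?_, explicit⟩
  simp only [barD1, barMul01, barMul10, lift_apply_of, map_sub, map_add,
    AddMonoidHom.sub_apply, AddMonoidHom.add_apply]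
  abel
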